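/- arXiv:2108.03846 — 2 statements merged into one kernel-verified Lean document; each statement's English description precedes it below -/
import Mathlib

section
/- With high probability, every vertex a of the random double digraph G_{n,ᾱ} has R₁-out-degree (the number of vertices b with R₁(a,b)) at most ⌈2/α₁⌉. -/
open MeasureTheory Finset

/-- The Bernoulli measure on `Bool` giving `true` probability `p` (for `p ∈ [0,1]`). -/
noncomputable def bern (p : ℝ) : Measure Bool :=
  ENNReal.ofReal p • Measure.dirac true + ENNReal.ofReal (1 - p) • Measure.dirac false

instance (p : ℝ) : IsFiniteMeasure (bern p) := by
  constructor
  simp only [bern, Measure.add_apply, Measure.smul_apply, smul_eq_mul]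
  exact ENNReal.add_lt_top.mpr
    ⟨ENNReal.mul_lt_top ENNReal.ofReal_lt_top (measure_lt_top _ _),
     ENNReal.mul_lt_top ENNReal.ofReal_lt_top (measure_lt_top _ _)⟩

/-- Sample space for the random double digraph `G_{n,ᾱ}`: for each ordered pair of
vertices, a coin for `R₁` and a coin for `R₂`. -/
abbrev Omega (n : ℕ) : Type := ((Fin n × Fin n) → Bool) × ((Fin n × Fin n) → Bool)

/-- The law of `G_{n,ᾱ}`: all coins independent, the `R₁`-coin of each pair has success
probability `n^{-(1+α₁)}` and the `R₂`-coin has success probability `n^{-(1-α₂)}`. -/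
noncomputable def digraphMeasure (α₁ α₂ : ℝ) (n : ℕ) : Measure (Omega n) :=
  (Measure.pi fun _ : Fin n × Fin n => bern ((n : ℝ) ^ (-(1 + α₁)))).prod
    (Measure.pi fun _ : Fin n × Fin n => bern ((n : ℝ) ^ (-(1 - α₂))))

/-- The (irreflexive) relation `R₁` of the sampled double digraph. -/
def Rone {n : ℕ} (ω : Omega n) (a b : Fin n) : Bool :=
  if a = b then false else ω.1 (a, b)

/-- The (irreflexive) relation `R₂` of the sampled double digraph. -/
def Rtwo {n : ℕ} (ω : Omega n) (a b : Fin n) : Bool :=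
  if a = b then false else ω.2 (a, b)

open scoped ENNReal Topology

theorem bern_isProbabilityMeasure {p : ℝ} (hp0 : 0 ≤ p) (hp1 : p ≤ 1) :
    IsProbabilityMeasure (bern p) := by
  constructor
  simp only [bern, Measure.add_apply, Measure.smul_apply, smul_eq_mul, measure_univ, mul_one]
  rw [← ENNReal.ofReal_add hp0 (by linarith)]
  simp

theorem bern_true (p : ℝ) : bern p {true} = ENNReal.ofReal p := by
  simp [bern]

/-- Under a product of Bernoulli measures, the coins in `T` all show `true` with probability
`p ^ #T`. -/
theorem pi_bern_forall_true {ι : Type*} [Fintype ι] {p : ℝ} (hp0 : 0 ≤ p) (hp1 : p ≤ 1)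
    (T : Finset ι) :
    (Measure.pi fun _ : ι => bern p) {f | ∀ i ∈ T, f i = true} = ENNReal.ofReal p ^ #T := by
  classical
  have := bern_isProbabilityMeasure hp0 hp1
  have hset : {f : ι → Bool | ∀ i ∈ T, f i = true} =
      Set.univ.pi fun i => if i ∈ T then {true} else Set.univ := by
    ext f
    simp only [Set.mem_ofPred_eq, Set.mem_pi, Set.mem_univ, true_implies]
    refine forall_congr' fun i => ?_
    by_cases hi : i ∈ T <;> simp [hi]
  rw [hset, Measure.pi_pi]
  have hterm : ∀ i, bern p (if i ∈ T then {true} else Set.univ) =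
      if i ∈ T then ENNReal.ofReal p else 1 := fun i => by
    split_ifs
    exacts [bern_true p, measure_univ]
  simp only [hterm]
  simp [Finset.prod_ite_mem]

theorem natCast_rpow_neg_le_one {n : ℕ} (hn : 1 ≤ n) {x : ℝ} (hx : 0 ≤ x) :
    (n : ℝ) ^ (-x) ≤ 1 :=
  Real.rpow_le_one_of_one_le_of_nonpos (by exact_mod_cast hn) (by linarith)

theorem digraphMeasure_isProbabilityMeasure {α₁ α₂ : ℝ} (h₁ : 0 ≤ 1 + α₁) (h₂ : 0 ≤ 1 - α₂)
    {n : ℕ} (hn : 1 ≤ n) : IsProbabilityMeasure (digraphMeasure α₁ α₂ n) := by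
  have := bern_isProbabilityMeasure (Real.rpow_nonneg n.cast_nonneg (-(1 + α₁)))
    (natCast_rpow_neg_le_one hn h₁)
  have := bern_isProbabilityMeasure (Real.rpow_nonneg n.cast_nonneg (-(1 - α₂)))
    (natCast_rpow_neg_le_one hn h₂)
  unfold digraphMeasure
  infer_instance

/-- The probability that `R₁` holds from `a` to every vertex of `S` (ignoring irreflexivity). -/
theorem digraphMeasure_forall_true {α₁ α₂ : ℝ} (h₁ : 0 ≤ 1 + α₁) (h₂ : 0 ≤ 1 - α₂)
    {n : ℕ} (hn : 1 ≤ n) (a : Fin n) (S : Finset (Fin n)) :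
    digraphMeasure α₁ α₂ n {ω | ∀ b ∈ S, ω.1 (a, b) = true} =
      ENNReal.ofReal ((n : ℝ) ^ (-(1 + α₁))) ^ #S := by
  have := bern_isProbabilityMeasure (Real.rpow_nonneg n.cast_nonneg (-(1 - α₂)))
    (natCast_rpow_neg_le_one hn h₂)
  have hset : {ω : Omega n | ∀ b ∈ S, ω.1 (a, b) = true} =
      {f | ∀ i ∈ S.map (Function.Embedding.sectR a (Fin n)), f i = true} ×ˢ Set.univ := by
    ext ω
    simp
  rw [hset, digraphMeasure, Measure.prod_prod, measure_univ, mul_one,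
    pi_bern_forall_true (Real.rpow_nonneg n.cast_nonneg _) (natCast_rpow_neg_le_one hn h₁),
    Finset.card_map]

/-- Union bound for the existence of a vertex of `R₁`-out-degree at least `k`. -/
theorem digraphMeasure_exists_outDegree_ge_le {α₁ α₂ : ℝ} (h₁ : 0 ≤ 1 + α₁) (h₂ : 0 ≤ 1 - α₂)
    {n : ℕ} (hn : 1 ≤ n) (k : ℕ) :
    digraphMeasure α₁ α₂ n
        {ω | ∃ a : Fin n, k ≤ #(Finset.univ.filter fun b => Rone ω a b = true)} ≤
      ENNReal.ofReal ((n : ℝ) ^ (1 - k * α₁)) := by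
  have hsub : {ω : Omega n | ∃ a : Fin n, k ≤ #(Finset.univ.filter fun b => Rone ω a b = true)} ⊆
      ⋃ x ∈ (Finset.univ : Finset (Fin n)) ×ˢ Finset.powersetCard k (Finset.univ : Finset (Fin n)),
        {ω : Omega n | ∀ b ∈ x.2, ω.1 (x.1, b) = true} := by
    rintro ω ⟨a, ha⟩
    obtain ⟨S, hS, hcard⟩ := Finset.exists_subset_card_eq ha
    simp only [Set.mem_iUnion]
    refine ⟨(a, S), by simp [hcard], fun b hb => ?_⟩
    have hR := (Finset.mem_filter.mp (hS hb)).2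
    unfold Rone at hR
    split_ifs at hR
    exact hR
  have hn0 : (0 : ℝ) < n := by exact_mod_cast hn
  calc _ ≤ _ := measure_mono hsub
    _ ≤ _ := measure_biUnion_finset_le _ _
    _ = ∑ x ∈ (Finset.univ : Finset (Fin n)) ×ˢ
          Finset.powersetCard k (Finset.univ : Finset (Fin n)),
          ENNReal.ofReal ((n : ℝ) ^ (-(1 + α₁))) ^ k := by
        refine Finset.sum_congr rfl fun x hx => ?_
        rw [digraphMeasure_forall_true h₁ h₂ hn,
          (Finset.mem_powersetCard.mp (Finset.mem_product.mp hx).2).2]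
    _ = ((n * n.choose k : ℕ) : ℝ≥0∞) * ENNReal.ofReal ((n : ℝ) ^ (-(1 + α₁))) ^ k := by
        simp
    _ ≤ ((n * n ^ k : ℕ) : ℝ≥0∞) * ENNReal.ofReal ((n : ℝ) ^ (-(1 + α₁))) ^ k := by
        gcongr
        exact Nat.choose_le_pow n k
    _ = ENNReal.ofReal ((n : ℝ) ^ (1 - k * α₁)) := by
        rw [← ENNReal.ofReal_natCast, ← ENNReal.ofReal_pow (Real.rpow_nonneg n.cast_nonneg _),
          ← ENNReal.ofReal_mul (Nat.cast_nonneg _)]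
        congr 1
        rw [← Real.rpow_mul_natCast hn0.le]
        push_cast
        rw [← pow_succ', ← Real.rpow_natCast, ← Real.rpow_add hn0]
        congr 1
        push_cast
        ring

/-- With high probability every vertex `a` of `G_{n,ᾱ}` has `R₁`-out-degree
at most `⌈2/α₁⌉`. -/
theorem statement1 (α₁ α₂ : ℝ) (h0 : 0 < α₁) (h12 : α₁ < α₂) (h2 : α₂ < 1/4) :
    Filter.Tendsto
      (fun n : ℕ => digraphMeasure α₁ α₂ n
        {ω : Omega n | ∀ a : Fin n,
          (Finset.univ.filter fun b => Rone ω a b = true).card ≤ ⌈(2 / α₁ : ℝ)⌉₊})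
      Filter.atTop (nhds 1) := by
  set d : ℕ := ⌈(2 / α₁ : ℝ)⌉₊
  have hexp : 0 < ((d + 1 : ℕ) : ℝ) * α₁ - 1 := by
    have hle := (div_le_iff₀ h0).mp (Nat.le_ceil (2 / α₁ : ℝ))
    push_cast
    nlinarith
  have hbound : Filter.Tendsto
      (fun n : ℕ => 1 - ENNReal.ofReal ((n : ℝ) ^ (1 - ((d + 1 : ℕ) : ℝ) * α₁)))
      Filter.atTop (𝓝 1) := by
    have hreal := (tendsto_rpow_neg_atTop hexp).comp (tendsto_natCast_atTop_atTop (R := ℝ))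
    have h := ENNReal.Tendsto.sub (tendsto_const_nhds (x := (1 : ℝ≥0∞)))
      (ENNReal.tendsto_ofReal hreal) (Or.inl ENNReal.one_ne_top)
    simpa [Function.comp_def] using h
  refine tendsto_of_tendsto_of_tendsto_of_le_of_le' hbound tendsto_const_nhds ?_ ?_
  · filter_upwards [Filter.eventually_ge_atTop 1] with n hn
    have := digraphMeasure_isProbabilityMeasure (α₁ := α₁) (α₂ := α₂) (by linarith)
      (by linarith) hn
    have hbad := digraphMeasure_exists_outDegree_ge_le (α₁ := α₁) (α₂ := α₂) (by linarith)
      (by linarith) hn (d + 1)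
    refine (tsub_le_tsub_left hbad 1).trans ?_
    rw [← prob_compl_eq_one_sub (Set.toFinite _).measurableSet]
    refine measure_mono fun ω hω a => ?_
    by_contra hlt
    exact hω ⟨a, by omega⟩
  · filter_upwards [Filter.eventually_ge_atTop 1] with n hn
    have := digraphMeasure_isProbabilityMeasure (α₁ := α₁) (α₂ := α₂) (by linarith)
      (by linarith) hn
    exact prob_le_one
end

section
/- (⊞₅, first bullet) There exists a real ε > 0 such that with high probability the height of the random double digraph G_{n,ᾱ} is at least n^ε; that is, the probability that height(G_{n,ᾱ}) ≥ n^ε tends to 1 as n → ∞. -/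
open MeasureTheory Finset

/-- `(levelAux R1 R2 a k).1 = S_{G,a,k}` and `(levelAux R1 R2 a k).2 = S_{G,a,0} ∪ ⋯ ∪ S_{G,a,k}`:
`S_0 = {a}`; given `S_0,…,S_k`, if some `R₁`-edge goes from `S_k` to a vertex outside
`S_0 ∪ ⋯ ∪ S_k` then `S_{k+1}` is the set of endpoints of such `R₁`-edges; otherwise, if some
`R₂`-edge does, `S_{k+1}` is the set of endpoints of such `R₂`-edges; otherwise `S_{k+1} = ∅`
(the process has stopped). -/
def levelAux {n : ℕ} (R1 R2 : Fin n → Fin n → Bool) (a : Fin n) :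
    ℕ → Finset (Fin n) × Finset (Fin n)
  | 0 => ({a}, {a})
  | k + 1 =>
    let p := levelAux R1 R2 a k
    let N1 := Finset.univ.filter fun b => b ∉ p.2 ∧ ∃ a' ∈ p.1, R1 a' b = true
    let N2 := Finset.univ.filter fun b => b ∉ p.2 ∧ ∃ a' ∈ p.1, R2 a' b = true
    let S := if N1.Nonempty then N1 else N2
    (S, p.2 ∪ S)

/-- The level set `S_{G,a,k}`. -/
def level {n : ℕ} (R1 R2 : Fin n → Fin n → Bool) (a : Fin n) (k : ℕ) : Finset (Fin n) :=
  (levelAux R1 R2 a k).1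

/-- The union `S_{G,a,0} ∪ ⋯ ∪ S_{G,a,k}`. -/
def levelUnion {n : ℕ} (R1 R2 : Fin n → Fin n → Bool) (a : Fin n) (k : ℕ) : Finset (Fin n) :=
  (levelAux R1 R2 a k).2

/-- `height(a,G)`: the first stage `k` at which the process stops, i.e. at which neither an
`R₁`-edge nor an `R₂`-edge leaves `S_k` towards the complement of `S_0 ∪ ⋯ ∪ S_k`
(equivalently, the first `k` with `S_{k+1} = ∅`). -/
noncomputable def heightAt {n : ℕ} (R1 R2 : Fin n → Fin n → Bool) (a : Fin n) : ℕ :=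
  sInf {k | level R1 R2 a (k + 1) = ∅}

/-- `height(G) = max {height(a,G) : a ∈ [n]}`. -/
noncomputable def heightG {n : ℕ} (R1 R2 : Fin n → Fin n → Bool) : ℕ :=
  Finset.univ.sup (fun a => heightAt R1 R2 a)

/-! ### The exploration process -/

section Exploration

variable {n : ℕ} (R1 R2 : Fin n → Fin n → Bool) (a : Fin n) (k : ℕ)

theorem levelAux_fst_subset_snd : (levelAux R1 R2 a k).1 ⊆ (levelAux R1 R2 a k).2 := by
  cases k with
  | zero => exact Finset.Subset.refl _
  | succ k => exact Finset.subset_union_right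

theorem levelAux_snd_succ :
    (levelAux R1 R2 a (k + 1)).2 = (levelAux R1 R2 a k).2 ∪ (levelAux R1 R2 a (k + 1)).1 :=
  rfl

theorem disjoint_levelAux_succ :
    Disjoint (levelAux R1 R2 a k).2 (levelAux R1 R2 a (k + 1)).1 := by
  rw [Finset.disjoint_right]
  intro b hb
  simp only [levelAux] at hb
  split_ifs at hb <;> exact (Finset.mem_filter.mp hb).2.1

theorem levelAux_snd_succ_sdiff_fst :
    (levelAux R1 R2 a (k + 1)).2 \ (levelAux R1 R2 a (k + 1)).1 = (levelAux R1 R2 a k).2 := by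
  rw [levelAux_snd_succ, Finset.union_sdiff_right]
  exact Finset.sdiff_eq_self_of_disjoint (disjoint_levelAux_succ R1 R2 a k)

/-- The process up to stage `k` only looks at the edges leaving `S_0 ∪ ⋯ ∪ S_{k-1}`. -/
theorem levelAux_congr (R1' R2' : Fin n → Fin n → Bool)
    (h : ∀ c ∈ (levelAux R1 R2 a k).2 \ (levelAux R1 R2 a k).1, R1' c = R1 c ∧ R2' c = R2 c) :
    levelAux R1' R2' a k = levelAux R1 R2 a k := by
  induction k with
  | zero => rfl
  | succ k ih =>
    rw [levelAux_snd_succ_sdiff_fst] at h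
    have hk := ih fun c hc => h c (Finset.mem_sdiff.mp hc).1
    have h1 : ∀ b, (∃ c ∈ (levelAux R1 R2 a k).1, R1' c b = true) ↔
        ∃ c ∈ (levelAux R1 R2 a k).1, R1 c b = true := fun b =>
      exists_congr fun c => and_congr_right fun hc => by
        rw [(h c (levelAux_fst_subset_snd R1 R2 a k hc)).1]
    have h2 : ∀ b, (∃ c ∈ (levelAux R1 R2 a k).1, R2' c b = true) ↔
        ∃ c ∈ (levelAux R1 R2 a k).1, R2 c b = true := fun b =>
      exists_congr fun c => and_congr_right fun hc => by
        rw [(h c (levelAux_fst_subset_snd R1 R2 a k hc)).2]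
    simp only [levelAux, hk, h1, h2]

theorem exists_level_succ_eq_empty : ∃ k, level R1 R2 a (k + 1) = ∅ := by
  by_contra! h
  have hcard : ∀ k, k + 1 ≤ #(levelAux R1 R2 a k).2 := by
    intro k
    induction k with
    | zero => simp [levelAux]
    | succ k ih =>
      rw [levelAux_snd_succ, Finset.card_union_of_disjoint (disjoint_levelAux_succ R1 R2 a k)]
      have := (h k).card_pos
      simp only [level] at this
      omega
  have h1 := hcard n
  have h2 := Finset.card_le_univ (levelAux R1 R2 a n).2
  rw [Fintype.card_fin] at h2
  omega

theorem le_heightG_of_level_nonempty {K : ℕ}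
    (h : ∀ k < K, (level R1 R2 a (k + 1)).Nonempty) : K ≤ heightG R1 R2 := by
  refine le_trans ?_ (Finset.le_sup (f := fun a => heightAt R1 R2 a) (Finset.mem_univ a))
  refine le_csInf (exists_level_succ_eq_empty R1 R2 a) fun k hk => ?_
  by_contra! hlt
  exact (h k hlt).ne_empty hk

end Exploration

/-! ### Bad steps -/

section BadStep

variable {n : ℕ}

/-- The pairs `(a, b)` with `a ∈ S` whose coin in `x` is a success. -/
def edgesFrom (x : Fin n × Fin n → Bool) (S : Finset (Fin n)) : Finset (Fin n × Fin n) :=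
  (S ×ˢ Finset.univ).filter fun e => x e = true

/-- The event that the exploration, at a stage with current level `S` and explored set `U`, either
finds too few edges (no `R₂`-edge leaves `U`, or no `R₁`-edge does although `S` has at least `T`
elements) or too many (more than `D * #S` for `R₂`, more than `#S` for `R₁`). -/
def badStep (T D : ℝ) (q : Finset (Fin n) × Finset (Fin n)) : Set (Omega n) :=
  {ω | q.1.Nonempty ∧ 2 * #q.2 ≤ n ∧
    ((∀ a ∈ q.1, ∀ b ∉ q.2, ω.2 (a, b) = false) ∨
     (T ≤ #q.1 ∧ ∀ a ∈ q.1, ∀ b ∉ q.2, ω.1 (a, b) = false) ∨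
     D * #q.1 < #(edgesFrom ω.2 q.1) ∨
     #q.1 < #(edgesFrom ω.1 q.1))}

theorem card_le_card_edgesFrom (x : Fin n × Fin n → Bool) (S N : Finset (Fin n))
    (h : ∀ b ∈ N, ∃ a ∈ S, x (a, b) = true) : #N ≤ #(edgesFrom x S) := by
  refine Finset.card_le_card_of_surjOn Prod.snd fun b hb => ?_
  obtain ⟨a, ha, hab⟩ := h b hb
  exact ⟨(a, b), by simp [edgesFrom, ha, hab], rfl⟩

theorem Rone_eq_true {ω : Omega n} {a b : Fin n} (h : Rone ω a b = true) : ω.1 (a, b) = true := by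
  unfold Rone at h
  split_ifs at h
  exact h

theorem Rtwo_eq_true {ω : Omega n} {a b : Fin n} (h : Rtwo ω a b = true) : ω.2 (a, b) = true := by
  unfold Rtwo at h
  split_ifs at h
  exact h

/-- A step that is not bad leads to a nonempty level of controlled size. -/
theorem level_succ_of_notMem_badStep {T D M : ℝ} {ω : Omega n} {a : Fin n} {k : ℕ} (hD : 0 ≤ D)
    (hTD : D * T ≤ M) (hgood : ω ∉ badStep T D (levelAux (Rone ω) (Rtwo ω) a k))
    (hne : (levelAux (Rone ω) (Rtwo ω) a k).1.Nonempty)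
    (hM : (#(levelAux (Rone ω) (Rtwo ω) a k).1 : ℝ) ≤ M)
    (hU : 2 * #(levelAux (Rone ω) (Rtwo ω) a k).2 ≤ n) :
    (levelAux (Rone ω) (Rtwo ω) a (k + 1)).1.Nonempty ∧
      (#(levelAux (Rone ω) (Rtwo ω) a (k + 1)).1 : ℝ) ≤ M := by
  have hsub := levelAux_fst_subset_snd (Rone ω) (Rtwo ω) a k
  simp only [levelAux]
  generalize levelAux (Rone ω) (Rtwo ω) a k = q at *
  simp only [badStep, Set.mem_ofPred_eq, not_and, not_or, not_lt] at hgood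
  obtain ⟨h2, h1, hc2, hc1⟩ := hgood hne hU
  split_ifs with hN1
  · refine ⟨hN1, le_trans ?_ hM⟩
    refine Nat.cast_le.mpr (le_trans (card_le_card_edgesFrom ω.1 q.1 _ fun b hb => ?_) hc1)
    obtain ⟨c, hc, hcb⟩ := (Finset.mem_filter.mp hb).2.2
    exact ⟨c, hc, Rone_eq_true hcb⟩
  · constructor
    · push Not at h2
      obtain ⟨c, hc, b, hb, hcb⟩ := h2
      refine ⟨b, Finset.mem_filter.mpr ⟨Finset.mem_univ _, hb, c, hc, ?_⟩⟩
      have : c ≠ b := fun h => hb (h ▸ hsub hc)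
      simpa [Rtwo, this] using hcb
    · have hT : (#q.1 : ℝ) < T := by
        by_contra! hT
        refine h1 hT fun c hc b hb => ?_
        by_contra hcb
        refine hN1 ⟨b, Finset.mem_filter.mpr ⟨Finset.mem_univ _, hb, c, hc, ?_⟩⟩
        have : c ≠ b := fun h => hb (h ▸ hsub hc)
        simpa [Rone, this] using hcb
      refine le_trans (Nat.cast_le.mpr (card_le_card_edgesFrom ω.2 q.1 _ fun b hb => ?_))
        (hc2.trans ((mul_le_mul_of_nonneg_left hT.le hD).trans hTD))
      obtain ⟨c, hc, hcb⟩ := (Finset.mem_filter.mp hb).2.2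
      exact ⟨c, hc, Rtwo_eq_true hcb⟩

/-- If none of the first `K` steps is bad, the process runs for at least `K` steps. -/
theorem le_heightG_of_forall_notMem_badStep {T D M : ℝ} {ω : Omega n} {a : Fin n} {K : ℕ}
    (hD : 0 ≤ D) (hTD : D * T ≤ M) (hM : 1 ≤ M) (hKM : 2 * (K * M) ≤ n)
    (hgood : ∀ k < K, ω ∉ badStep T D (levelAux (Rone ω) (Rtwo ω) a k)) :
    K ≤ heightG (Rone ω) (Rtwo ω) := by
  have key : ∀ k ≤ K, (levelAux (Rone ω) (Rtwo ω) a k).1.Nonempty ∧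
      (#(levelAux (Rone ω) (Rtwo ω) a k).1 : ℝ) ≤ M ∧
      (#(levelAux (Rone ω) (Rtwo ω) a k).2 : ℝ) ≤ (k + 1) * M := by
    intro k
    induction k with
    | zero => intro _; simpa [levelAux] using hM
    | succ k ih =>
      intro hk
      obtain ⟨hne, hS, hU⟩ := ih (by omega)
      have hkK : (k + 1 : ℝ) ≤ K := by exact_mod_cast hk
      have hU' : 2 * #(levelAux (Rone ω) (Rtwo ω) a k).2 ≤ n := by
        have : (2 * #(levelAux (Rone ω) (Rtwo ω) a k).2 : ℝ) ≤ n := by nlinarith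
        exact_mod_cast this
      obtain ⟨hne', hS'⟩ := level_succ_of_notMem_badStep hD hTD (hgood k (by omega)) hne hS hU'
      refine ⟨hne', hS', ?_⟩
      have hcard : (#(levelAux (Rone ω) (Rtwo ω) a (k + 1)).2 : ℝ) ≤
          #(levelAux (Rone ω) (Rtwo ω) a k).2 + #(levelAux (Rone ω) (Rtwo ω) a (k + 1)).1 := by
        exact_mod_cast Finset.card_union_le _ _
      push_cast
      linarith
  exact le_heightG_of_level_nonempty _ _ a fun k hk => (key (k + 1) hk).1

end BadStep

/-! ### Independence of disjoint sets of rows -/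

section Independence

variable {n : ℕ} {p₁ p₂ : ℝ}

theorem isProbabilityMeasure_bern {p : ℝ} (h0 : 0 ≤ p) (h1 : p ≤ 1) :
    IsProbabilityMeasure (bern p) := by
  constructor
  simp [bern, ← ENNReal.ofReal_add h0 (sub_nonneg.mpr h1)]

theorem bern_singleton_false (p : ℝ) : bern p {false} = ENNReal.ofReal (1 - p) := by
  simp [bern]

/-- The law of a double digraph with edge probabilities `p₁` and `p₂`. -/
noncomputable abbrev coinMeasure (n : ℕ) (p₁ p₂ : ℝ) : Measure (Omega n) :=
  (Measure.pi fun _ => bern p₁).prod (Measure.pi fun _ => bern p₂)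

/-- The event `A` depends only on the edges leaving the vertices in `S`. -/
def RowDetermined (S : Finset (Fin n)) (A : Set (Omega n)) : Prop :=
  ∀ ω ω' : Omega n, (∀ a ∈ S, ∀ b, ω.1 (a, b) = ω'.1 (a, b) ∧ ω.2 (a, b) = ω'.2 (a, b)) →
    ω ∈ A → ω' ∈ A

theorem measure_pi_inter_eq_mul {ι : Type*} [Fintype ι] {μ : ι → Measure Bool}
    [∀ i, IsProbabilityMeasure (μ i)] {I J : Finset ι} (hIJ : Disjoint I J)
    {A B : Set (ι → Bool)}
    (hA : ∀ x y : ι → Bool, (∀ i ∈ I, x i = y i) → x ∈ A → y ∈ A)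
    (hB : ∀ x y : ι → Bool, (∀ i ∈ J, x i = y i) → x ∈ B → y ∈ B) :
    Measure.pi μ (A ∩ B) = Measure.pi μ A * Measure.pi μ B := by
  have hind := ProbabilityTheory.iIndepFun.indepFun_finset I J hIJ
    (ProbabilityTheory.iIndepFun_pi (μ := μ) (X := fun _ => id) fun _ => aemeasurable_id)
    fun i => measurable_pi_apply i
  have hpre : ∀ (K : Finset ι) (C : Set (ι → Bool)),
      (∀ x y : ι → Bool, (∀ i ∈ K, x i = y i) → x ∈ C → y ∈ C) →
      (fun (x : ι → Bool) (i : K) => id (x i)) ⁻¹'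
        ((fun (x : ι → Bool) (i : K) => id (x i)) '' C) = C := by
    intro K C hC
    refine Set.Subset.antisymm ?_ (Set.subset_preimage_image _ _)
    rintro y ⟨x, hx, hxy⟩
    exact hC x y (fun i hi => congrFun hxy ⟨i, hi⟩) hx
  have := ProbabilityTheory.indepFun_iff_measure_inter_preimage_eq_mul.mp hind
    ((fun (x : ι → Bool) (i : I) => id (x i)) '' A) ((fun (x : ι → Bool) (i : J) => id (x i)) '' B)
    (Set.toFinite _).measurableSet (Set.toFinite _).measurableSet
  rwa [hpre I A hA, hpre J B hB] at this

theorem RowDetermined.measure_inter_eq_mul [IsProbabilityMeasure (bern p₁)]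
    [IsProbabilityMeasure (bern p₂)] {S T : Finset (Fin n)} {A B : Set (Omega n)}
    (hA : RowDetermined S A) (hB : RowDetermined T B) (hST : Disjoint S T) :
    coinMeasure n p₁ p₂ (A ∩ B) = coinMeasure n p₁ p₂ A * coinMeasure n p₁ p₂ B := by
  let μ : (Fin n × Fin n) ⊕ (Fin n × Fin n) → Measure Bool :=
    Sum.elim (fun _ => bern p₁) (fun _ => bern p₂)
  have : ∀ i, IsProbabilityMeasure (μ i) := by
    rintro (i | i)
    · exact inferInstanceAs (IsProbabilityMeasure (bern p₁))
    · exact inferInstanceAs (IsProbabilityMeasure (bern p₂))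
  have hmp := measurePreserving_sumPiEquivProdPi μ
  have hset : ∀ C : Set (Omega n), coinMeasure n p₁ p₂ C =
      Measure.pi μ (MeasurableEquiv.sumPiEquivProdPi (fun _ => Bool) ⁻¹' C) := fun C =>
    (hmp.measure_preimage_equiv C).symm
  let rows (R : Finset (Fin n)) : Finset ((Fin n × Fin n) ⊕ (Fin n × Fin n)) :=
    (R ×ˢ Finset.univ).disjSum (R ×ˢ Finset.univ)
  have hrows : ∀ (R : Finset (Fin n)) (C : Set (Omega n)), RowDetermined R C →
      ∀ x y : (Fin n × Fin n) ⊕ (Fin n × Fin n) → Bool, (∀ i ∈ rows R, x i = y i) →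
      x ∈ MeasurableEquiv.sumPiEquivProdPi (fun _ => Bool) ⁻¹' C →
      y ∈ MeasurableEquiv.sumPiEquivProdPi (fun _ => Bool) ⁻¹' C := by
    intro R C hC x y hxy hx
    refine hC _ _ (fun a ha b => ⟨?_, ?_⟩) hx
    · exact hxy (Sum.inl (a, b)) (by simp [rows, ha])
    · exact hxy (Sum.inr (a, b)) (by simp [rows, ha])
  rw [hset, hset, hset, Set.preimage_inter]
  refine measure_pi_inter_eq_mul (I := rows S) (J := rows T) ?_ (hrows S A hA) (hrows T B hB)
  rw [Finset.disjoint_left] at hST ⊢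
  rintro (⟨a, b⟩ | ⟨a, b⟩) h1 h2 <;> simp only [rows, Finset.inl_mem_disjSum,
    Finset.inr_mem_disjSum, Finset.mem_product, Finset.mem_univ, and_true] at h1 h2 <;>
    exact hST h1 h2

theorem rowDetermined_levelAux_eq (a : Fin n) (k : ℕ) (q : Finset (Fin n) × Finset (Fin n)) :
    RowDetermined (q.2 \ q.1) {ω : Omega n | levelAux (Rone ω) (Rtwo ω) a k = q} := by
  rintro ω ω' h rfl
  refine levelAux_congr _ _ a k _ _ fun c hc => ⟨?_, ?_⟩ <;> funext b
  · simp only [Rone, (h c hc b).1]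
  · simp only [Rtwo, (h c hc b).2]

theorem edgesFrom_congr {x y : Fin n × Fin n → Bool} {S : Finset (Fin n)}
    (h : ∀ a ∈ S, ∀ b, x (a, b) = y (a, b)) : edgesFrom x S = edgesFrom y S := by
  refine Finset.filter_congr fun e he => ?_
  rw [h e.1 (Finset.mem_product.mp he).1 e.2]

theorem rowDetermined_badStep (T D : ℝ) (q : Finset (Fin n) × Finset (Fin n)) :
    RowDetermined q.1 (badStep T D q) := by
  rintro ω ω' h ⟨hne, hU, hbad⟩
  refine ⟨hne, hU, ?_⟩
  rw [← edgesFrom_congr fun a ha b => (h a ha b).1, ← edgesFrom_congr fun a ha b => (h a ha b).2]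
  refine hbad.imp (fun H a ha b hb => ?_) (Or.imp_left (And.imp_right fun H a ha b hb => ?_))
  · rw [← (h a ha b).2, H a ha b hb]
  · rw [← (h a ha b).1, H a ha b hb]

/-- A uniform bound on the probability of a bad step gives a union bound along the exploration. -/
theorem measure_exists_mem_badStep_le [IsProbabilityMeasure (bern p₁)]
    [IsProbabilityMeasure (bern p₂)] {T D : ℝ} {β : ENNReal} (a : Fin n) (K : ℕ)
    (hβ : ∀ q, coinMeasure n p₁ p₂ (badStep T D q) ≤ β) :
    coinMeasure n p₁ p₂ {ω | ∃ k < K, ω ∈ badStep T D (levelAux (Rone ω) (Rtwo ω) a k)} ≤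
      K * β := by
  let F (k : ℕ) (q : Finset (Fin n) × Finset (Fin n)) : Set (Omega n) :=
    {ω | levelAux (Rone ω) (Rtwo ω) a k = q}
  have hsub : {ω : Omega n | ∃ k < K, ω ∈ badStep T D (levelAux (Rone ω) (Rtwo ω) a k)} ⊆
      ⋃ k ∈ Finset.range K, ⋃ q ∈ Finset.univ, F k q ∩ badStep T D q := by
    rintro ω ⟨k, hk, hω⟩
    simp only [Set.mem_iUnion]
    exact ⟨k, Finset.mem_range.mpr hk, levelAux (Rone ω) (Rtwo ω) a k, Finset.mem_univ _, rfl, hω⟩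
  have hone : ∀ k, ∑ q, coinMeasure n p₁ p₂ (F k q) = 1 := by
    intro k
    have hdisj : Set.PairwiseDisjoint (↑(Finset.univ : Finset (Finset (Fin n) × Finset (Fin n))))
        (F k) := fun q _ q' _ hqq' => Set.disjoint_left.mpr fun ω h h' =>
      hqq' (Eq.trans (Eq.symm h) h')
    rw [← measure_biUnion_finset hdisj fun q _ => (Set.toFinite _).measurableSet]
    convert! measure_univ (μ := coinMeasure n p₁ p₂)
    exact Set.eq_univ_of_forall fun ω => Set.mem_biUnion (Finset.mem_univ _) rfl
  calc _ ≤ _ := measure_mono hsub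
    _ ≤ ∑ k ∈ Finset.range K, ∑ q, coinMeasure n p₁ p₂ (F k q ∩ badStep T D q) :=
        (measure_biUnion_finset_le _ _).trans
          (Finset.sum_le_sum fun k _ => measure_biUnion_finset_le _ _)
    _ ≤ ∑ k ∈ Finset.range K, ∑ q, coinMeasure n p₁ p₂ (F k q) * β := by
        refine Finset.sum_le_sum fun k _ => Finset.sum_le_sum fun q _ => ?_
        rw [(rowDetermined_levelAux_eq a k q).measure_inter_eq_mul (rowDetermined_badStep T D q)
          Finset.sdiff_disjoint]
        exact mul_le_mul_right (hβ q) _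
    _ = K * β := by simp [← Finset.sum_mul, hone]

end Independence

/-! ### The probability of a bad step -/

section Estimates

variable {ι : Type*} [Fintype ι] {p : ℝ}

theorem measure_pi_bern_forall_false (I : Finset ι) [IsProbabilityMeasure (bern p)] :
    Measure.pi (fun _ : ι => bern p) {x | ∀ i ∈ I, x i = false} = ENNReal.ofReal (1 - p) ^ #I := by
  classical
  have : {x : ι → Bool | ∀ i ∈ I, x i = false} =
      Set.pi Set.univ fun i => if i ∈ I then {false} else Set.univ := by
    ext x
    simp only [Set.mem_ofPred_eq, Set.mem_univ_pi]
    refine forall_congr' fun i => ?_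
    split_ifs with h <;> simp [h]
  rw [this, Measure.pi_pi]
  simp only [apply_ite (bern p), bern_singleton_false, measure_univ, Finset.prod_ite_mem,
    Finset.univ_inter, Finset.prod_const]

theorem measure_pi_bern_forall_false_le (I : Finset ι) (h0 : 0 ≤ p) (h1 : p ≤ 1) {c : ℝ}
    (hc : 0 < c) (hcI : c ≤ p * #I) :
    Measure.pi (fun _ : ι => bern p) {x | ∀ i ∈ I, x i = false} ≤ ENNReal.ofReal c⁻¹ := by
  have := isProbabilityMeasure_bern h0 h1
  rw [measure_pi_bern_forall_false, ← ENNReal.ofReal_pow (by linarith)]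
  refine ENNReal.ofReal_le_ofReal ?_
  calc (1 - p) ^ #I ≤ Real.exp (-p) ^ #I :=
        pow_le_pow_left₀ (by linarith) (Real.one_sub_le_exp_neg p) _
    _ = (Real.exp (p * #I))⁻¹ := by rw [← Real.exp_nat_mul, ← Real.exp_neg]; ring_nf
    _ ≤ c⁻¹ := inv_anti₀ hc (hcI.trans (by linarith [Real.add_one_le_exp (p * #I)]))

theorem measure_pi_bern_lt_card_filter_le (I : Finset ι) (h0 : 0 ≤ p) (h1 : p ≤ 1) {c d : ℝ}
    (hc : 0 < c) (hcI : p * #I ≤ d * c) :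
    Measure.pi (fun _ : ι => bern p) {x | c < #(I.filter fun i => x i = true)} ≤
      ENNReal.ofReal d := by
  have := isProbabilityMeasure_bern h0 h1
  have hmean : ∫⁻ x, (#(I.filter fun i => x i = true) : ENNReal)
      ∂Measure.pi (fun _ : ι => bern p) = ENNReal.ofReal (p * #I) := by
    have hcoord : ∀ i, ∫⁻ x : ι → Bool, (if x i = true then 1 else 0)
        ∂Measure.pi (fun _ : ι => bern p) = ENNReal.ofReal p := by
      intro i
      have h := (measurePreserving_eval (fun _ : ι => bern p) i).lintegral_comp
        (f := fun b : Bool => if b = true then (1 : ENNReal) else 0) (measurable_of_countable _)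
      refine h.trans ?_
      simp [bern, lintegral_add_measure, lintegral_smul_measure]
    simp only [Finset.card_filter, Nat.cast_sum, Nat.cast_ite, Nat.cast_one, Nat.cast_zero]
    rw [lintegral_finsetSum _ fun i _ => measurable_of_countable _]
    simp only [hcoord, Finset.sum_const, nsmul_eq_mul]
    rw [ENNReal.ofReal_mul h0, ENNReal.ofReal_natCast, mul_comm]
  have hmarkov := meas_ge_le_lintegral_div (μ := Measure.pi (fun _ : ι => bern p))
    (f := fun x : ι → Bool => (#(I.filter fun i => x i = true) : ENNReal))
    (measurable_of_countable _).aemeasurable (ε := ENNReal.ofReal c)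
    (by simpa using hc) ENNReal.ofReal_ne_top
  refine (measure_mono fun x hx => ?_).trans (hmarkov.trans ?_)
  · rw [Set.mem_ofPred_eq, ← ENNReal.ofReal_natCast]
    exact ENNReal.ofReal_le_ofReal (le_of_lt hx)
  · rw [hmean, ← ENNReal.ofReal_div_of_pos hc]
    exact ENNReal.ofReal_le_ofReal ((div_le_iff₀ hc).mpr hcI)

/-- All four ways for a step to be bad have probability at most `δ`. -/
theorem measure_badStep_le {n : ℕ} {p₁ p₂ T D δ : ℝ} (hp₁ : 0 ≤ p₁) (hp₁' : p₁ ≤ 1) (hp₂ : 0 ≤ p₂)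
    (hp₂' : p₂ ≤ 1) (hδ : 0 < δ) (hD : 0 < D) (hfew₂ : δ⁻¹ ≤ p₂ * (n / 2))
    (hfew₁ : δ⁻¹ ≤ p₁ * (T * (n / 2))) (hmany₂ : p₂ * n ≤ δ * D) (hmany₁ : p₁ * n ≤ δ)
    (q : Finset (Fin n) × Finset (Fin n)) :
    coinMeasure n p₁ p₂ (badStep T D q) ≤ 4 * ENNReal.ofReal δ := by
  have := isProbabilityMeasure_bern hp₁ hp₁'
  have := isProbabilityMeasure_bern hp₂ hp₂'
  by_cases hq : q.1.Nonempty ∧ 2 * #q.2 ≤ n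
  swap
  · rw [show badStep T D q = ∅ from Set.eq_empty_of_forall_notMem fun ω h => hq ⟨h.1, h.2.1⟩]
    simp
  obtain ⟨hne, hU⟩ := hq
  have hS : (1 : ℝ) ≤ #q.1 := by exact_mod_cast hne.card_pos
  have hcompl : (n / 2 : ℝ) ≤ #q.2ᶜ := by
    rw [Finset.card_compl, Fintype.card_fin, Nat.cast_sub (by omega)]
    have : (2 * #q.2 : ℝ) ≤ n := by exact_mod_cast hU
    linarith
  have hn : (0 : ℝ) ≤ n := Nat.cast_nonneg n
  have hfst : ∀ A : Set (Fin n × Fin n → Bool), coinMeasure n p₁ p₂ {ω | ω.1 ∈ A} =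
      Measure.pi (fun _ => bern p₁) A := fun A =>
    measurePreserving_fst.measure_preimage (Set.toFinite A).measurableSet.nullMeasurableSet
  have hsnd : ∀ A : Set (Fin n × Fin n → Bool), coinMeasure n p₁ p₂ {ω | ω.2 ∈ A} =
      Measure.pi (fun _ => bern p₂) A := fun A =>
    measurePreserving_snd.measure_preimage (Set.toFinite A).measurableSet.nullMeasurableSet
  let few : Set (Fin n × Fin n → Bool) := {x | ∀ e ∈ q.1 ×ˢ q.2ᶜ, x e = false}
  have hfew : ∀ x : Fin n × Fin n → Bool, (∀ a ∈ q.1, ∀ b ∉ q.2, x (a, b) = false) → x ∈ few := by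
    intro x hx e he
    rw [Finset.mem_product, Finset.mem_compl] at he
    exact hx e.1 he.1 e.2 he.2
  have h1 : coinMeasure n p₁ p₂ {ω | ω.2 ∈ few} ≤ ENNReal.ofReal δ := by
    rw [hsnd, ← inv_inv δ]
    refine measure_pi_bern_forall_false_le _ hp₂ hp₂' (inv_pos.mpr hδ) (hfew₂.trans ?_)
    rw [Finset.card_product, Nat.cast_mul]
    gcongr
    nlinarith
  have h2 : coinMeasure n p₁ p₂ {ω | T ≤ #q.1 ∧ ω.1 ∈ few} ≤ ENNReal.ofReal δ := by
    by_cases hT : T ≤ #q.1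
    · refine (measure_mono fun ω h => h.2).trans ((hfst few).trans_le ?_)
      rw [← inv_inv δ]
      refine measure_pi_bern_forall_false_le _ hp₁ hp₁' (inv_pos.mpr hδ) (hfew₁.trans ?_)
      rw [Finset.card_product, Nat.cast_mul]
      gcongr
    · simp [hT]
  have h3 : coinMeasure n p₁ p₂ {ω | ω.2 ∈ {x | D * #q.1 < #(edgesFrom x q.1)}} ≤
      ENNReal.ofReal δ := by
    rw [hsnd]
    refine measure_pi_bern_lt_card_filter_le _ hp₂ hp₂' (by positivity) ?_
    rw [Finset.card_product, Finset.card_univ, Fintype.card_fin, Nat.cast_mul]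
    nlinarith
  have h4 : coinMeasure n p₁ p₂ {ω | ω.1 ∈ {x | (#q.1 : ℝ) < #(edgesFrom x q.1)}} ≤
      ENNReal.ofReal δ := by
    rw [hfst]
    refine measure_pi_bern_lt_card_filter_le _ hp₁ hp₁' (by positivity) ?_
    rw [Finset.card_product, Finset.card_univ, Fintype.card_fin, Nat.cast_mul]
    nlinarith
  have hsub : badStep T D q ⊆ ({ω | ω.2 ∈ few} ∪ {ω | T ≤ #q.1 ∧ ω.1 ∈ few}) ∪
      ({ω | ω.2 ∈ {x | D * #q.1 < #(edgesFrom x q.1)}} ∪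
        {ω | ω.1 ∈ {x | (#q.1 : ℝ) < #(edgesFrom x q.1)}}) := by
    rintro ω ⟨-, -, h | h | h | h⟩
    · exact Or.inl (Or.inl (hfew _ h))
    · exact Or.inl (Or.inr ⟨h.1, hfew _ h.2⟩)
    · exact Or.inr (Or.inl h)
    · exact Or.inr (Or.inr (Nat.cast_lt (α := ℝ).mpr h :))
  calc _ ≤ _ := measure_mono hsub
    _ ≤ (ENNReal.ofReal δ + ENNReal.ofReal δ) + (ENNReal.ofReal δ + ENNReal.ofReal δ) :=
        (measure_union_le _ _).trans (add_le_add ((measure_union_le _ _).trans (add_le_add h1 h2))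
          ((measure_union_le _ _).trans (add_le_add h3 h4)))
    _ = 4 * ENNReal.ofReal δ := by ring

end Estimates

/-- A quantitative form: the height is below `n ^ ε` with probability at most `16 * n ^ (-ε)`. -/
theorem one_sub_le_digraphMeasure {α₁ α₂ ε : ℝ} (h12 : α₁ < α₂) (h2 : α₂ < 1 / 4)
    (hε : 0 < ε) (hε₁ : 2 * ε ≤ α₁) (hε₂ : 2 * ε ≤ 1 / 16) {n : ℕ} (hn : 1 ≤ n)
    (hlarge : 4 ≤ (n : ℝ) ^ (11 / 32 : ℝ)) :
    1 - ENNReal.ofReal (16 * (n : ℝ) ^ (-ε)) ≤ digraphMeasure α₁ α₂ n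
      {ω : Omega n | (n : ℝ) ^ ε ≤ (heightG (Rone ω) (Rtwo ω) : ℝ)} := by
  have hn1 : (1 : ℝ) ≤ n := by exact_mod_cast hn
  have hn0 : (0 : ℝ) < n := by linarith
  set p₁ : ℝ := (n : ℝ) ^ (-(1 + α₁)) with hp₁
  set p₂ : ℝ := (n : ℝ) ^ (-(1 - α₂)) with hp₂
  have hp₁1 : p₁ ≤ 1 := Real.rpow_le_one_of_one_le_of_nonpos hn1 (by linarith)
  have hp₂1 : p₂ ≤ 1 := Real.rpow_le_one_of_one_le_of_nonpos hn1 (by linarith)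
  have hp₁0 : 0 ≤ p₁ := by positivity
  have hp₂0 : 0 ≤ p₂ := by positivity
  have := isProbabilityMeasure_bern hp₁0 hp₁1
  have := isProbabilityMeasure_bern hp₂0 hp₂1
  have hp₁n : p₁ * n = (n : ℝ) ^ (-α₁) := by
    rw [hp₁, ← Real.rpow_add_one hn0.ne']; ring_nf
  have hp₂n : p₂ * n = (n : ℝ) ^ α₂ := by
    rw [hp₂, ← Real.rpow_add_one hn0.ne']; ring_nf
  set δ : ℝ := 2 * (n : ℝ) ^ (-(2 * ε)) with hδ
  set T : ℝ := (n : ℝ) ^ (5 / 16 : ℝ) with hT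
  set D : ℝ := (n : ℝ) ^ (α₂ + 1 / 16) with hD
  set M : ℝ := (n : ℝ) ^ (5 / 8 : ℝ) with hM
  have hδinv : δ⁻¹ = (n : ℝ) ^ (2 * ε) / 2 := by
    rw [hδ, mul_inv, ← Real.rpow_neg hn0.le, neg_neg]; ring
  have hmono : ∀ {x y : ℝ}, x ≤ y → (n : ℝ) ^ x ≤ (n : ℝ) ^ y := fun h =>
    Real.rpow_le_rpow_of_exponent_le hn1 h
  have hβ := measure_badStep_le (T := T) (D := D) (δ := δ) hp₁0 hp₁1 hp₂0 hp₂1 (by positivity)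
    (by positivity)
    (by
      rw [hδinv, ← mul_div_assoc, hp₂n]
      linarith [hmono (show 2 * ε ≤ α₂ by linarith)])
    (by
      have : p₁ * (T * (n / 2)) = (n : ℝ) ^ (-α₁ + 5 / 16) / 2 := by
        rw [Real.rpow_add hn0, ← hp₁n]; ring
      rw [hδinv, this]
      linarith [hmono (show 2 * ε ≤ -α₁ + 5 / 16 by linarith)])
    (by
      rw [hp₂n, hδ, hD, mul_assoc, ← Real.rpow_add hn0]
      have : (0 : ℝ) < (n : ℝ) ^ α₂ := by positivity
      linarith [hmono (show α₂ ≤ -(2 * ε) + (α₂ + 1 / 16) by linarith)])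
    (by
      rw [hp₁n, hδ]
      have : (0 : ℝ) < (n : ℝ) ^ (-α₁) := by positivity
      linarith [hmono (show -α₁ ≤ -(2 * ε) by linarith)])
  set K : ℕ := ⌈(n : ℝ) ^ ε⌉₊ with hK
  have hK2 : (K : ℝ) ≤ 2 * (n : ℝ) ^ ε := by
    have h1 : (1 : ℝ) ≤ (n : ℝ) ^ ε := Real.one_le_rpow hn1 hε.le
    linarith [Nat.ceil_lt_add_one (show 0 ≤ (n : ℝ) ^ ε by positivity)]
  have hDT : D * T ≤ M := by
    rw [hD, hT, ← Real.rpow_add hn0]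
    exact hmono (by linarith)
  have hKM : 2 * (K * M) ≤ n := by
    have hM0 : 0 < M := by positivity
    calc 2 * (K * M) ≤ 2 * ((2 * (n : ℝ) ^ (1 / 32 : ℝ)) * M) := by
          gcongr
          linarith [hmono (show ε ≤ 1 / 32 by linarith)]
      _ = 4 * (n : ℝ) ^ (21 / 32 : ℝ) := by
          rw [show (21 / 32 : ℝ) = 1 / 32 + 5 / 8 by norm_num, Real.rpow_add hn0]; ring
      _ ≤ (n : ℝ) ^ (11 / 32 : ℝ) * (n : ℝ) ^ (21 / 32 : ℝ) := by gcongr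
      _ = n := by rw [← Real.rpow_add hn0]; norm_num
  let a : Fin n := ⟨0, hn⟩
  have hbad := measure_exists_mem_badStep_le a K hβ
  have hKδ : (K : ENNReal) * (4 * ENNReal.ofReal δ) ≤ ENNReal.ofReal (16 * (n : ℝ) ^ (-ε)) := by
    rw [← ENNReal.ofReal_natCast, show (4 : ENNReal) = ENNReal.ofReal 4 by simp,
      ← ENNReal.ofReal_mul (by norm_num), ← ENNReal.ofReal_mul (by positivity)]
    refine ENNReal.ofReal_le_ofReal ?_
    calc K * (4 * δ) ≤ (2 * (n : ℝ) ^ ε) * (4 * δ) := by gcongr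
      _ = 16 * ((n : ℝ) ^ ε * (n : ℝ) ^ (-(2 * ε))) := by rw [hδ]; ring
      _ = 16 * (n : ℝ) ^ (-ε) := by rw [← Real.rpow_add hn0]; ring_nf
  rw [tsub_le_iff_right]
  calc (1 : ENNReal) = coinMeasure n p₁ p₂ Set.univ := measure_univ.symm
    _ ≤ coinMeasure n p₁ p₂ ({ω | (n : ℝ) ^ ε ≤ (heightG (Rone ω) (Rtwo ω) : ℝ)} ∪
          {ω | ∃ k < K, ω ∈ badStep T D (levelAux (Rone ω) (Rtwo ω) a k)}) := by
        refine measure_mono fun ω _ => or_iff_not_imp_right.mpr fun h => ?_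
        have hgood : ∀ k < K, ω ∉ badStep T D (levelAux (Rone ω) (Rtwo ω) a k) :=
          fun k hk hω => h ⟨k, hk, hω⟩
        exact (Nat.le_ceil _).trans (Nat.cast_le.mpr (le_heightG_of_forall_notMem_badStep
          (by positivity) hDT (Real.one_le_rpow hn1 (by norm_num)) hKM hgood))
    _ ≤ _ := (measure_union_le _ _).trans (add_le_add le_rfl (hbad.trans hKδ))


/-- ⊞₅, first bullet: There exists a real `ε > 0` such that with high
probability `height(G_{n,ᾱ}) ≥ n^ε`. -/
theorem statement10 (α₁ α₂ : ℝ) (h0 : 0 < α₁) (h12 : α₁ < α₂) (h2 : α₂ < 1/4) :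
    ∃ ε : ℝ, 0 < ε ∧
      Filter.Tendsto
        (fun n : ℕ => digraphMeasure α₁ α₂ n
          {ω : Omega n | (n : ℝ) ^ ε ≤ (heightG (Rone ω) (Rtwo ω) : ℝ)})
        Filter.atTop (nhds 1) := by
  have hε : 0 < min α₁ (1 / 16) / 2 := by positivity
  refine ⟨min α₁ (1 / 16) / 2, hε, ?_⟩
  have hlow : Filter.Tendsto (fun n : ℕ =>
      1 - ENNReal.ofReal (16 * (n : ℝ) ^ (-(min α₁ (1 / 16) / 2)))) Filter.atTop (nhds 1) := by
    have h := ((tendsto_rpow_neg_atTop hε).comp tendsto_natCast_atTop_atTop).const_mul (16 : ℝ)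
    simpa using ENNReal.Tendsto.sub tendsto_const_nhds (ENNReal.tendsto_ofReal h)
      (Or.inl ENNReal.one_ne_top)
  refine tendsto_of_tendsto_of_tendsto_of_le_of_le' hlow tendsto_const_nhds ?_ ?_
  · have hlarge := ((tendsto_rpow_atTop (show (0 : ℝ) < 11 / 32 by norm_num)).comp
      tendsto_natCast_atTop_atTop).eventually_ge_atTop 4
    filter_upwards [hlarge, Filter.eventually_ge_atTop 1] with n hn hn1
    exact one_sub_le_digraphMeasure h12 h2 hε (by linarith [min_le_left α₁ (1 / 16)])
      (by linarith [min_le_right α₁ (1 / 16)]) hn1 hn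
  · filter_upwards [Filter.eventually_ge_atTop 1] with n hn1
    have hn : (1 : ℝ) ≤ n := by exact_mod_cast hn1
    have := isProbabilityMeasure_bern (p := (n : ℝ) ^ (-(1 + α₁))) (by positivity)
      (Real.rpow_le_one_of_one_le_of_nonpos hn (by linarith))
    have := isProbabilityMeasure_bern (p := (n : ℝ) ^ (-(1 - α₂))) (by positivity)
      (Real.rpow_le_one_of_one_le_of_nonpos hn (by linarith))
    exact prob_le_one (μ := coinMeasure n _ _)
end
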